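/- Let σ_P, σ_R, p, r > 0, δ > r and b > 0. Set β = √((2r/σ_R² − 1)² + 8δ/σ_R²) − 1 and α = ½[√((2r/σ_R² − 1)² + 8δ/σ_R²) − (1 + 2r/σ_R²)] (so α > 0). Define A = E(b, α) D(0, α+1) + D(b, α) E(0, α+1) and V(u) = [D(0, α+1) E(u, α+1) − E(0, α+1) D(u, α+1)] / ((α+1) A). Then A > 0, V is twice differentiable on (0, b), and V satisfies: (i) ½(σ_P² + σ_R² u²) V''(u) + (p + r u) V'(u) = δ V(u) for all u ∈ (0, b); (ii) V(0) = 0; (iii) V'(b) = 1. -/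

import Mathlib

open Real Filter MeasureTheory Set

/-- The fundamental solution `D(x, λ)` of Paulsen–Gjessing (1997a), used in
Examples 3.2, 4.1 and 4.2 of Yin–Wen:
`D(x,λ) = σP^{-(1+β)} σR^{-(1+λ)} ∫_{arctan(σR x/σP)}^{π/2}
  (cos t)^{β-λ} (σP sin t - σR x cos t)^λ exp(-2pt/(σPσR)) dt`. -/
noncomputable def Dfun (σP σR p β x lam : ℝ) : ℝ :=
  σP ^ (-(1 + β)) * σR ^ (-(1 + lam)) *
    ∫ t in Real.arctan (σR * x / σP)..(Real.pi / 2),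
      Real.cos t ^ (β - lam) * (σP * Real.sin t - σR * x * Real.cos t) ^ lam *
        Real.exp (-2 * p * t / (σP * σR))

/-- The fundamental solution `E(x, λ)` of Paulsen–Gjessing (1997a):
`E(x,λ) = σP^{-(1+β)} σR^{-(1+λ)} ∫_{-π/2}^{arctan(σR x/σP)}
  (cos t)^{β-λ} (σR x cos t - σP sin t)^λ exp(-2pt/(σPσR)) dt`. -/
noncomputable def Efun (σP σR p β x lam : ℝ) : ℝ :=
  σP ^ (-(1 + β)) * σR ^ (-(1 + lam)) *
    ∫ t in (-(Real.pi / 2))..Real.arctan (σR * x / σP),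
      Real.cos t ^ (β - lam) * (σR * x * Real.cos t - σP * Real.sin t) ^ lam *
        Real.exp (-2 * p * t / (σP * σR))

/-- The kernel obtained from the integrand of `Dfun` by the substitution `y = σP tan t / σR`. -/
noncomputable def diffusionKernel (σP σR p β y : ℝ) : ℝ :=
  (σP ^ 2 + σR ^ 2 * y ^ 2) ^ (-(1 + β / 2)) *
    Real.exp (-2 * p * Real.arctan (σR * y / σP) / (σP * σR))

/-- The derivative of `diffusionKernel` in its last argument. -/
noncomputable def diffusionKernelDeriv (σP σR p β y : ℝ) : ℝ :=
  -((2 + β) * σR ^ 2 * y + 2 * p) / (σP ^ 2 + σR ^ 2 * y ^ 2) * diffusionKernel σP σR p β y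

section Kernel

variable {σP σR p β : ℝ}

lemma diffusionKernel_pos (hσP : 0 < σP) (y : ℝ) : 0 < diffusionKernel σP σR p β y := by
  have : 0 < σP ^ 2 + σR ^ 2 * y ^ 2 := by positivity
  unfold diffusionKernel
  positivity

lemma hasDerivAt_diffusionKernel (hσP : 0 < σP) (hσR : 0 < σR) (y : ℝ) :
    HasDerivAt (diffusionKernel σP σR p β) (diffusionKernelDeriv σP σR p β y) y := by
  have hQ : 0 < σP ^ 2 + σR ^ 2 * y ^ 2 := by positivity
  have h1 : HasDerivAt (fun y => σP ^ 2 + σR ^ 2 * y ^ 2) (σR ^ 2 * (2 * y)) y := by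
    simpa using ((hasDerivAt_pow 2 y).const_mul (σR ^ 2)).const_add (σP ^ 2)
  have h2 := h1.rpow_const (p := -(1 + β / 2)) (Or.inl hQ.ne')
  have h3 : HasDerivAt (fun y => σR * y / σP) (σR / σP) y := by
    simpa using ((hasDerivAt_id y).const_mul σR).div_const σP
  have h4 := ((h3.arctan.const_mul (-2 * p)).div_const (σP * σR)).exp
  refine (h2.mul h4).congr_deriv ?_
  rw [Real.rpow_sub_one hQ.ne']
  have h5 : 1 / (1 + (σR * y / σP) ^ 2) = σP ^ 2 / (σP ^ 2 + σR ^ 2 * y ^ 2) := by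
    have : 0 < 1 + (σR * y / σP) ^ 2 := by positivity
    rw [div_eq_div_iff this.ne' hQ.ne']
    field_simp
  rw [h5, diffusionKernelDeriv, diffusionKernel]
  field_simp
  ring

lemma continuous_diffusionKernel (hσP : 0 < σP) (hσR : 0 < σR) :
    Continuous (diffusionKernel σP σR p β) :=
  continuous_iff_continuousAt.2 fun y => (hasDerivAt_diffusionKernel hσP hσR y).continuousAt

lemma continuous_diffusionKernelDeriv (hσP : 0 < σP) (hσR : 0 < σR) :
    Continuous (diffusionKernelDeriv σP σR p β) := by
  have h : ∀ y : ℝ, σP ^ 2 + σR ^ 2 * y ^ 2 ≠ 0 := fun y => by positivity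
  exact (Continuous.div (by fun_prop) (by fun_prop) h).mul (continuous_diffusionKernel hσP hσR)

lemma exists_diffusionKernel_add_le (hσP : 0 < σP) (hσR : 0 < σR) (hβ : 0 < β) (R : ℝ) :
    ∃ M, 0 < M ∧ ∀ x, |x| ≤ R → ∀ z,
      diffusionKernel σP σR p β (x + z) ≤ M * (1 + z ^ 2) ^ (-(1 + β / 2)) := by
  obtain ⟨c, hc, hcz⟩ : ∃ c : ℝ, 0 < c ∧ ∀ x, |x| ≤ R → ∀ z,
      c * (1 + z ^ 2) ≤ σP ^ 2 + σR ^ 2 * (x + z) ^ 2 := by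
    refine ⟨min (σP ^ 2 / (1 + 2 * R ^ 2)) (σR ^ 2 / 2), by positivity, fun x hx z => ?_⟩
    set c := min (σP ^ 2 / (1 + 2 * R ^ 2)) (σR ^ 2 / 2)
    have hc0 : 0 ≤ c := by positivity
    have h1 : c * (1 + 2 * R ^ 2) ≤ σP ^ 2 :=
      (le_div_iff₀ (by positivity)).1 (min_le_left _ _)
    have h2 : c ≤ σR ^ 2 / 2 := min_le_right _ _
    have hx2 : x ^ 2 ≤ R ^ 2 := sq_le_sq' (by linarith [neg_abs_le x]) (by linarith [le_abs_self x])
    have hz : 1 + z ^ 2 ≤ (1 + 2 * R ^ 2) + 2 * (x + z) ^ 2 := by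
      nlinarith [sq_nonneg (2 * x + z)]
    calc c * (1 + z ^ 2) ≤ c * ((1 + 2 * R ^ 2) + 2 * (x + z) ^ 2) := by gcongr
      _ = c * (1 + 2 * R ^ 2) + c * (2 * (x + z) ^ 2) := by ring
      _ ≤ σP ^ 2 + σR ^ 2 / 2 * (2 * (x + z) ^ 2) := by gcongr
      _ = _ := by ring
  refine ⟨c ^ (-(1 + β / 2)) * Real.exp (2 * |p| * (Real.pi / 2) / (σP * σR)), by positivity,
    fun x hx z => ?_⟩
  have h1 : (σP ^ 2 + σR ^ 2 * (x + z) ^ 2) ^ (-(1 + β / 2)) ≤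
      c ^ (-(1 + β / 2)) * (1 + z ^ 2) ^ (-(1 + β / 2)) := by
    rw [← Real.mul_rpow hc.le (by positivity)]
    exact Real.rpow_le_rpow_of_nonpos (by positivity) (hcz x hx z) (by linarith)
  have h2 : -2 * p * Real.arctan (σR * (x + z) / σP) ≤ 2 * |p| * (Real.pi / 2) := by
    have h3 : |Real.arctan (σR * (x + z) / σP)| ≤ Real.pi / 2 :=
      abs_le.2 ⟨(Real.neg_pi_div_two_lt_arctan _).le, (Real.arctan_lt_pi_div_two _).le⟩
    calc _ ≤ |-2 * p * Real.arctan (σR * (x + z) / σP)| := le_abs_self _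
      _ = 2 * |p| * |Real.arctan (σR * (x + z) / σP)| := by simp [abs_mul]
      _ ≤ _ := by gcongr
  calc diffusionKernel σP σR p β (x + z)
      ≤ (c ^ (-(1 + β / 2)) * (1 + z ^ 2) ^ (-(1 + β / 2))) *
        Real.exp (2 * |p| * (Real.pi / 2) / (σP * σR)) := by
        unfold diffusionKernel
        gcongr
    _ = _ := by ring

lemma exists_abs_diffusionKernelDeriv_le (hσP : 0 < σP) (hσR : 0 < σR) (hβ : 0 < β) :
    ∃ C, 0 < C ∧ ∀ y, |diffusionKernelDeriv σP σR p β y| ≤ C * diffusionKernel σP σR p β y := by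
  refine ⟨(2 + β) * (σR / σP) + 2 * |p| / σP ^ 2, by positivity, fun y => ?_⟩
  have hQ : 0 < σP ^ 2 + σR ^ 2 * y ^ 2 := by positivity
  rw [diffusionKernelDeriv, abs_mul, abs_of_pos (diffusionKernel_pos hσP y), abs_div, abs_neg,
    abs_of_pos hQ]
  refine mul_le_mul_of_nonneg_right ?_ (diffusionKernel_pos hσP y).le
  rw [div_le_iff₀ hQ]
  have h1 : |(2 + β) * σR ^ 2 * y + 2 * p| ≤ (2 + β) * σR ^ 2 * |y| + 2 * |p| := by
    refine (abs_add_le _ _).trans (le_of_eq ?_)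
    rw [abs_mul _ y, abs_mul 2 p, abs_of_pos (show 0 < (2 + β) * σR ^ 2 by positivity),
      abs_of_pos (two_pos : (0 : ℝ) < 2)]
  have h2 : σR ^ 2 * |y| ≤ σR / σP * (σP ^ 2 + σR ^ 2 * y ^ 2) := by
    have h3 : σP * (σR * |y|) ≤ σP ^ 2 + σR ^ 2 * y ^ 2 := by
      rw [← sq_abs y]
      nlinarith [sq_nonneg (σP - σR * |y|), mul_nonneg hσP.le (mul_nonneg hσR.le (abs_nonneg y))]
    calc σR ^ 2 * |y| = σR / σP * (σP * (σR * |y|)) := by field_simp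
      _ ≤ _ := by gcongr
  have h4 : 2 * |p| ≤ 2 * |p| / σP ^ 2 * (σP ^ 2 + σR ^ 2 * y ^ 2) := by
    rw [mul_add, div_mul_cancel₀ _ (by positivity)]
    have : 0 ≤ 2 * |p| / σP ^ 2 * (σR ^ 2 * y ^ 2) := by positivity
    linarith
  have h5 := mul_le_mul_of_nonneg_left h2 (show 0 ≤ 2 + β by positivity)
  linarith

lemma integrableOn_rpow_mul_one_add_sq_rpow {μ γ : ℝ} (hμ : 0 ≤ μ) (h : 1 < 2 * γ - μ) :
    IntegrableOn (fun z : ℝ => z ^ μ * (1 + z ^ 2) ^ (-γ)) (Set.Ioi 0) := by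
  have h1 : Integrable (fun z : ℝ => (1 + ‖z‖ ^ 2) ^ (-(2 * γ - μ) / 2)) :=
    integrable_rpow_neg_one_add_norm_sq (by simpa using h)
  refine h1.integrableOn.mono' (by fun_prop) ?_
  filter_upwards [ae_restrict_mem measurableSet_Ioi] with z hz
  have hz : 0 < z := hz
  have hz2 : 0 < 1 + z ^ 2 := by positivity
  rw [Real.norm_of_nonneg (by positivity), Real.norm_of_nonneg hz.le,
    show -(2 * γ - μ) / 2 = μ / 2 + -γ by ring, Real.rpow_add hz2]
  gcongr
  calc z ^ μ = (z ^ 2) ^ (μ / 2) := by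
        rw [← Real.rpow_natCast, ← Real.rpow_mul hz.le]
        congr 1
        push_cast
        ring
    _ ≤ _ := by gcongr; linarith

lemma tendsto_rpow_mul_diffusionKernel_atTop (hσP : 0 < σP) (hσR : 0 < σR) (hβ : 0 < β)
    {μ : ℝ} (hμ : μ < 2 + β) (x : ℝ) :
    Tendsto (fun z => z ^ μ * diffusionKernel σP σR p β (x + z)) atTop (nhds 0) := by
  obtain ⟨M, hM, hK⟩ := exists_diffusionKernel_add_le (p := p) hσP hσR hβ |x|
  have h1 : Tendsto (fun z : ℝ => M * z ^ (-(2 + β - μ))) atTop (nhds 0) := by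
    simpa using (tendsto_rpow_neg_atTop (show 0 < 2 + β - μ by linarith)).const_mul M
  refine squeeze_zero' ?_ ?_ h1
  · filter_upwards [eventually_gt_atTop 0] with z hz
    exact mul_nonneg (by positivity) (diffusionKernel_pos hσP _).le
  · filter_upwards [eventually_gt_atTop 0] with z hz
    have h2 : (1 + z ^ 2) ^ (-(1 + β / 2)) ≤ z ^ (-(2 + β)) := by
      calc (1 + z ^ 2) ^ (-(1 + β / 2)) ≤ (z ^ 2) ^ (-(1 + β / 2)) :=
            Real.rpow_le_rpow_of_nonpos (by positivity) (by linarith) (by linarith)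
        _ = _ := by
          rw [← Real.rpow_natCast, ← Real.rpow_mul hz.le]
          congr 1
          push_cast
          ring
    calc z ^ μ * diffusionKernel σP σR p β (x + z)
        ≤ z ^ μ * (M * z ^ (-(2 + β))) := by
          gcongr
          exact (hK x le_rfl z).trans (by gcongr)
      _ = M * (z ^ μ * z ^ (-(2 + β))) := by ring
      _ = _ := by
        rw [← Real.rpow_add hz]
        congr 2
        ring

/-- `diffusionKernel` integrated against a power of the distance to the base point. -/
noncomputable def kernelMoment (σP σR p β μ x : ℝ) : ℝ :=
  ∫ z in Set.Ioi (0 : ℝ), z ^ μ * diffusionKernel σP σR p β (x + z)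

/-- `diffusionKernelDeriv` integrated against a power of the distance to the base point. -/
noncomputable def kernelDerivMoment (σP σR p β μ x : ℝ) : ℝ :=
  ∫ z in Set.Ioi (0 : ℝ), z ^ μ * diffusionKernelDeriv σP σR p β (x + z)

lemma integrableOn_kernelMoment (hσP : 0 < σP) (hσR : 0 < σR) (hβ : 0 < β)
    {μ : ℝ} (hμ : 0 ≤ μ) (hμβ : μ < 1 + β) (x : ℝ) :
    IntegrableOn (fun z => z ^ μ * diffusionKernel σP σR p β (x + z)) (Set.Ioi 0) := by
  obtain ⟨M, hM, hK⟩ := exists_diffusionKernel_add_le (p := p) hσP hσR hβ |x|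
  have h1 := (integrableOn_rpow_mul_one_add_sq_rpow hμ
    (show 1 < 2 * (1 + β / 2) - μ by linarith)).const_mul M
  have hc := continuous_diffusionKernel (p := p) (β := β) hσP hσR
  refine h1.mono' (Measurable.aestronglyMeasurable (by fun_prop)) ?_
  filter_upwards [ae_restrict_mem measurableSet_Ioi] with z hz
  have hz : 0 < z := hz
  rw [norm_mul, Real.norm_of_nonneg (diffusionKernel_pos hσP _).le,
    Real.norm_of_nonneg (by positivity)]
  calc _ ≤ z ^ μ * (M * (1 + z ^ 2) ^ (-(1 + β / 2))) := by
        gcongr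
        exact hK x le_rfl z
    _ = _ := by ring

lemma hasDerivAt_kernelMoment (hσP : 0 < σP) (hσR : 0 < σR) (hβ : 0 < β)
    {μ : ℝ} (hμ : 0 ≤ μ) (hμβ : μ < 1 + β) (x : ℝ) :
    IntegrableOn (fun z => z ^ μ * diffusionKernelDeriv σP σR p β (x + z)) (Set.Ioi 0) ∧
    HasDerivAt (kernelMoment σP σR p β μ) (kernelDerivMoment σP σR p β μ x) x := by
  obtain ⟨M, hM, hK⟩ := exists_diffusionKernel_add_le (p := p) hσP hσR hβ (|x| + 1)
  obtain ⟨C, hC, hK'⟩ := exists_abs_diffusionKernelDeriv_le (p := p) hσP hσR hβ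
  have h1 := (integrableOn_rpow_mul_one_add_sq_rpow hμ
    (show 1 < 2 * (1 + β / 2) - μ by linarith)).const_mul (C * M)
  have hc := continuous_diffusionKernel (p := p) (β := β) hσP hσR
  have hc' := continuous_diffusionKernelDeriv (p := p) (β := β) hσP hσR
  refine hasDerivAt_integral_of_dominated_loc_of_deriv_le
    (F := fun x z => z ^ μ * diffusionKernel σP σR p β (x + z))
    (F' := fun x z => z ^ μ * diffusionKernelDeriv σP σR p β (x + z))
    (Metric.ball_mem_nhds x one_pos) ?_ (integrableOn_kernelMoment hσP hσR hβ hμ hμβ x)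
    (Measurable.aestronglyMeasurable (by fun_prop)) ?_ h1 ?_
  · exact Eventually.of_forall fun y => Measurable.aestronglyMeasurable (by fun_prop)
  · filter_upwards [ae_restrict_mem measurableSet_Ioi] with z hz y hy
    have hz : 0 < z := hz
    have hy : |y| ≤ |x| + 1 := by
      have h2 : |y - x| < 1 := by simpa [Real.dist_eq] using hy
      have h3 := abs_sub_abs_le_abs_sub y x
      linarith
    rw [norm_mul, Real.norm_of_nonneg (show 0 ≤ z ^ μ by positivity), Real.norm_eq_abs]
    calc _ ≤ z ^ μ * (C * (M * (1 + z ^ 2) ^ (-(1 + β / 2)))) := by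
          gcongr
          exact (hK' _).trans (by gcongr; exact hK y hy z)
      _ = _ := by ring
  · refine Eventually.of_forall fun z y _ => ?_
    exact ((hasDerivAt_diffusionKernel hσP hσR (y + z)).comp_add_const y z).const_mul _

lemma kernelDerivMoment_add_one (hσP : 0 < σP) (hσR : 0 < σR) (hβ : 0 < β)
    {μ : ℝ} (hμ : 0 ≤ μ) (hμβ : μ < β) (x : ℝ) :
    kernelDerivMoment σP σR p β (μ + 1) x = -((μ + 1) * kernelMoment σP σR p β μ x) := by
  have hi := integrableOn_kernelMoment (p := p) hσP hσR hβ hμ (by linarith) x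
  have hi' := (hasDerivAt_kernelMoment (p := p) hσP hσR hβ (show 0 ≤ μ + 1 by linarith)
    (by linarith) x).1
  have hc := continuous_diffusionKernel (p := p) (β := β) hσP hσR
  have key := integral_Ioi_of_hasDerivAt_of_tendsto (a := 0)
    (f := fun z => z ^ (μ + 1) * diffusionKernel σP σR p β (x + z))
    (f' := fun z => (μ + 1) * (z ^ μ * diffusionKernel σP σR p β (x + z)) +
      z ^ (μ + 1) * diffusionKernelDeriv σP σR p β (x + z)) ?_ ?_
    ((hi.const_mul _).add hi')
    (tendsto_rpow_mul_diffusionKernel_atTop hσP hσR hβ (by linarith) x)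
  · rw [integral_add (hi.const_mul _) hi', integral_const_mul,
      Real.zero_rpow (by linarith)] at key
    simp only [kernelMoment, kernelDerivMoment]
    linarith
  · refine ContinuousAt.continuousWithinAt (ContinuousAt.mul ?_ (by fun_prop))
    exact Real.continuousAt_rpow_const _ _ (Or.inr (by linarith))
  · intro z hz
    have h1 := Real.hasDerivAt_rpow_const (x := z) (p := μ + 1) (Or.inr (by linarith))
    have h2 := (hasDerivAt_diffusionKernel (p := p) (β := β) hσP hσR (x + z)).comp_const_add x z
    refine (h1.mul h2).congr_deriv ?_
    rw [add_sub_cancel_right]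
    ring

lemma hasDerivAt_kernelMoment_add_one (hσP : 0 < σP) (hσR : 0 < σR) (hβ : 0 < β)
    {μ : ℝ} (hμ : 0 ≤ μ) (hμβ : μ < β) (x : ℝ) :
    HasDerivAt (kernelMoment σP σR p β (μ + 1)) (-((μ + 1) * kernelMoment σP σR p β μ x)) x := by
  rw [← kernelDerivMoment_add_one hσP hσR hβ hμ hμβ]
  exact (hasDerivAt_kernelMoment hσP hσR hβ (by linarith) (by linarith) x).2

lemma kernelMoment_ode (hσP : 0 < σP) (hσR : 0 < σR) (hβ : 0 < β)
    {r δ α : ℝ} (hα : 0 ≤ α) (hαβ : α < β) (hβα : β * σR ^ 2 = 2 * α * σR ^ 2 + 2 * r)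
    (hδ : δ = σR ^ 2 / 2 * (α + 1) * α + r * (α + 1)) (x : ℝ) :
    (1 / 2) * (σP ^ 2 + σR ^ 2 * x ^ 2) * ((α + 1) * kernelDerivMoment σP σR p β α x) +
      (p + r * x) * ((α + 1) * kernelMoment σP σR p β α x) +
      δ * kernelMoment σP σR p β (α + 1) x = 0 := by
  have hi := integrableOn_kernelMoment (p := p) hσP hσR hβ hα (by linarith) x
  have hi1 := integrableOn_kernelMoment (p := p) hσP hσR hβ (show 0 ≤ α + 1 by linarith)
    (by linarith) x
  have hi' := (hasDerivAt_kernelMoment (p := p) hσP hσR hβ hα (by linarith) x).1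
  have hc := continuous_diffusionKernel (p := p) (β := β) hσP hσR
  set a := (1 / 2) * (σP ^ 2 + σR ^ 2 * x ^ 2) * (α + 1) with ha
  set b := (p + r * x) * (α + 1) with hb
  have htend : Tendsto (fun z => -(α + 1) * σR ^ 2 * (x *
      (z ^ (α + 1) * diffusionKernel σP σR p β (x + z)) +
      1 / 2 * (z ^ (α + 2) * diffusionKernel σP σR p β (x + z)))) atTop (nhds 0) := by
    have h1 := tendsto_rpow_mul_diffusionKernel_atTop (p := p) hσP hσR hβ
      (show α + 1 < 2 + β by linarith) x
    have h2 := tendsto_rpow_mul_diffusionKernel_atTop (p := p) hσP hσR hβ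
      (show α + 2 < 2 + β by linarith) x
    simpa only [mul_zero, add_zero] using
      ((h1.const_mul x).add (h2.const_mul (1 / 2))).const_mul (-(α + 1) * σR ^ 2)
  have hiab : IntegrableOn (fun z => a * (z ^ α * diffusionKernelDeriv σP σR p β (x + z)) +
      b * (z ^ α * diffusionKernel σP σR p β (x + z))) (Set.Ioi 0) :=
    (hi'.const_mul _).add (hi.const_mul _)
  have key := integral_Ioi_of_hasDerivAt_of_tendsto (a := 0)
    (f := fun z => -(α + 1) * σR ^ 2 * (x *
      (z ^ (α + 1) * diffusionKernel σP σR p β (x + z)) +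
      1 / 2 * (z ^ (α + 2) * diffusionKernel σP σR p β (x + z))))
    (f' := fun z => (a * (z ^ α * diffusionKernelDeriv σP σR p β (x + z)) +
      b * (z ^ α * diffusionKernel σP σR p β (x + z))) +
      δ * (z ^ (α + 1) * diffusionKernel σP σR p β (x + z))) ?_ ?_
    (hiab.add (hi1.const_mul _)) htend
  · rw [integral_add hiab (hi1.const_mul _),
      integral_add (hi'.const_mul _) (hi.const_mul _), integral_const_mul, integral_const_mul,
      integral_const_mul, Real.zero_rpow (by linarith), Real.zero_rpow (by linarith)] at key
    simp only [kernelMoment, kernelDerivMoment]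
    linear_combination key
  · have h1 : ContinuousAt (fun z : ℝ => z ^ (α + 1)) 0 :=
      Real.continuousAt_rpow_const _ _ (Or.inr (by linarith))
    have h2 : ContinuousAt (fun z : ℝ => z ^ (α + 2)) 0 :=
      Real.continuousAt_rpow_const _ _ (Or.inr (by linarith))
    exact ContinuousAt.continuousWithinAt (by fun_prop)
  · intro z hz
    have hz : 0 < z := hz
    have hQ : 0 < σP ^ 2 + σR ^ 2 * (x + z) ^ 2 := by positivity
    have h1 := Real.hasDerivAt_rpow_const (x := z) (p := α + 1) (Or.inr (by linarith))
    have h2 := Real.hasDerivAt_rpow_const (x := z) (p := α + 2) (Or.inr (by linarith))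
    have h3 := (hasDerivAt_diffusionKernel (p := p) (β := β) hσP hσR (x + z)).comp_const_add x z
    refine ((((h1.mul h3).const_mul x).add ((h2.mul h3).const_mul (1 / 2))).const_mul
      (-(α + 1) * σR ^ 2)).congr_deriv ?_
    have e1 : z ^ (α + 1) = z ^ α * z := Real.rpow_add_one hz.ne' α
    have e2 : z ^ (α + 2) = z ^ α * z ^ 2 := by
      rw [Real.rpow_add hz, Real.rpow_two]
    rw [add_sub_cancel_right, show α + 2 - 1 = α + 1 by ring, e1, e2, diffusionKernelDeriv]
    obtain rfl : r = (β * σR ^ 2 - 2 * α * σR ^ 2) / 2 := by linarith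
    rw [ha, hb, hδ]
    field_simp
    ring

lemma kernelMoment_pos (hσP : 0 < σP) (hσR : 0 < σR) (hβ : 0 < β)
    {μ : ℝ} (hμ : 0 ≤ μ) (hμβ : μ < 1 + β) (x : ℝ) : 0 < kernelMoment σP σR p β μ x := by
  have hpos : ∀ z ∈ Set.Ioi (0 : ℝ), 0 < z ^ μ * diffusionKernel σP σR p β (x + z) :=
    fun z hz => mul_pos (Real.rpow_pos_of_pos hz _) (diffusionKernel_pos hσP _)
  rw [kernelMoment, setIntegral_pos_iff_support_of_nonneg_ae
    ((ae_restrict_iff' measurableSet_Ioi).2 (Eventually.of_forall fun z hz => (hpos z hz).le))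
    (integrableOn_kernelMoment hσP hσR hβ hμ hμβ x),
    Set.inter_eq_right.2 fun z hz => Function.mem_support.2 (hpos z hz).ne']
  simp

lemma Dfun_eq_kernelMoment (hσP : 0 < σP) (hσR : 0 < σR) (x lam : ℝ) :
    Dfun σP σR p β x lam = kernelMoment σP σR p β lam x := by
  have himage : (fun z => Real.arctan (σR * (x + z) / σP)) '' Set.Ioi 0 =
      Set.Ioo (Real.arctan (σR * x / σP)) (Real.pi / 2) := by
    ext t
    constructor
    · rintro ⟨z, hz, rfl⟩
      refine ⟨Real.arctan_strictMono ?_, Real.arctan_lt_pi_div_two _⟩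
      have hz : 0 < z := hz
      gcongr
      linarith
    · rintro ⟨h1, h2⟩
      have h3 : -(Real.pi / 2) < t := (Real.neg_pi_div_two_lt_arctan _).trans h1
      refine ⟨σP * Real.tan t / σR - x, ?_, ?_⟩
      · have h4 : σR * x / σP < Real.tan t := by
          rwa [← Real.arctan_strictMono.lt_iff_lt, Real.arctan_tan h3 h2]
        rw [div_lt_iff₀ hσP] at h4
        have : x < σP * Real.tan t / σR := by
          rw [lt_div_iff₀ hσR]
          linarith
        exact sub_pos.2 this
      · have : σR * (x + (σP * Real.tan t / σR - x)) / σP = Real.tan t := by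
          field_simp
          ring
        simp only [this, Real.arctan_tan h3 h2]
  have hderiv : ∀ z ∈ Set.Ioi (0 : ℝ),
      HasDerivWithinAt (fun z => Real.arctan (σR * (x + z) / σP))
        (1 / (1 + (σR * (x + z) / σP) ^ 2) * (σR / σP)) (Set.Ioi 0) z := by
    intro z _
    have h1 : HasDerivAt (fun z => σR * (x + z) / σP) (σR / σP) z := by
      simpa using (((hasDerivAt_id z).const_add x).const_mul σR).div_const σP
    exact h1.arctan.hasDerivWithinAt
  have hinj : Set.InjOn (fun z => Real.arctan (σR * (x + z) / σP)) (Set.Ioi 0) := by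
    intro z _ w _ h
    have h1 := Real.arctan_injective h
    field_simp at h1
    linarith
  rw [Dfun, intervalIntegral.integral_of_le (Real.arctan_lt_pi_div_two _).le,
    integral_Ioc_eq_integral_Ioo, ← himage,
    integral_image_eq_integral_abs_deriv_smul measurableSet_Ioi hderiv hinj, kernelMoment,
    ← integral_const_mul]
  refine setIntegral_congr_fun measurableSet_Ioi fun z hz => ?_
  have hz : 0 < z := hz
  simp only [smul_eq_mul]
  set τ := σR * (x + z) / σP with hτ
  have hcos : 0 < Real.cos (Real.arctan τ) := Real.cos_arctan_pos τ
  have hsin : σP * Real.sin (Real.arctan τ) - σR * x * Real.cos (Real.arctan τ) =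
      Real.cos (Real.arctan τ) * (σR * z) := by
    have h1 : Real.sin (Real.arctan τ) = τ * Real.cos (Real.arctan τ) := by
      rw [Real.sin_arctan, Real.cos_arctan]
      ring
    rw [h1, hτ]
    field_simp
    ring
  have hQ : σP ^ 2 + σR ^ 2 * (x + z) ^ 2 = (σP / Real.cos (Real.arctan τ)) ^ 2 := by
    rw [div_pow, Real.cos_sq_arctan, hτ]
    field_simp
  have hτ0 : (0 : ℝ) < 1 / (1 + τ ^ 2) * (σR / σP) := by positivity
  rw [abs_of_pos hτ0, hsin, diffusionKernel, hQ, ← hτ, ← Real.cos_sq_arctan,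
    Real.mul_rpow hcos.le (by positivity), Real.mul_rpow hσR.le hz.le,
    ← Real.rpow_natCast (σP / _), ← Real.rpow_mul (by positivity),
    Real.div_rpow hσP.le hcos.le, Real.rpow_sub hcos]
  set c := Real.cos (Real.arctan τ)
  have e1 : ((2 : ℕ) : ℝ) * -(1 + β / 2) = -(1 + β) - 1 := by push_cast; ring
  have e2 : c ^ (-(1 + β) - 1) = (c ^ β * c ^ 2)⁻¹ := by
    rw [← Real.rpow_natCast c 2, ← Real.rpow_add hcos, ← Real.rpow_neg hcos.le]
    congr 1
    push_cast
    ring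
  have e3 : σR ^ (-(1 + lam)) = (σR ^ lam * σR)⁻¹ := by
    rw [← Real.rpow_add_one hσR.ne', ← Real.rpow_neg hσR.le]
    congr 1
    ring
  rw [e1, Real.rpow_sub_one hσP.ne', e2, e3]
  have := Real.rpow_pos_of_pos hcos lam
  have := Real.rpow_pos_of_pos hcos β
  have := Real.rpow_pos_of_pos hσR lam
  field_simp

lemma Efun_eq_Dfun_neg (x lam : ℝ) :
    Efun σP σR p β x lam = Dfun σP σR (-p) β (-x) lam := by
  have h := intervalIntegral.integral_comp_neg (a := -(Real.pi / 2))
    (b := Real.arctan (σR * x / σP)) (fun t => Real.cos t ^ (β - lam) *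
      (σP * Real.sin t - σR * -x * Real.cos t) ^ lam * Real.exp (-2 * -p * t / (σP * σR)))
  rw [Efun, Dfun, show σR * -x / σP = -(σR * x / σP) by ring, Real.arctan_neg]
  rw [neg_neg] at h
  rw [← h]
  congr 1
  refine intervalIntegral.integral_congr fun t _ => ?_
  simp only [Real.cos_neg, Real.sin_neg]
  congr 2 <;> ring_nf

end Kernel

/-- Example 4.2 (barrier strategy, `ρ = 0`): with
`A = E(b, α) D(0, α+1) + D(b, α) E(0, α+1)`, the function
`V(u) = [D(0, α+1) E(u, α+1) - E(0, α+1) D(u, α+1)] / ((α+1) A)`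
solves `½(σP² + σR² u²)V'' + (p + ru)V' = δ V` on `(0, b)` with `V(0) = 0`
and `V'(b) = 1`; moreover `A > 0`. -/
theorem barrier_dividend_value_function
    (σP σR p r δ b : ℝ)
    (hσP : 0 < σP) (hσR : 0 < σR) (hp : 0 < p) (hr : 0 < r) (hδ : r < δ)
    (hb : 0 < b)
    (β α : ℝ)
    (hβ : β = Real.sqrt ((2 * r / σR ^ 2 - 1) ^ 2 + 8 * δ / σR ^ 2) - 1)
    (hα : α = (Real.sqrt ((2 * r / σR ^ 2 - 1) ^ 2 + 8 * δ / σR ^ 2)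
        - (1 + 2 * r / σR ^ 2)) / 2)
    (A : ℝ)
    (hA : A = Efun σP σR p β b α * Dfun σP σR p β 0 (α + 1)
        + Dfun σP σR p β b α * Efun σP σR p β 0 (α + 1))
    (V : ℝ → ℝ)
    (hV : V = fun u =>
        (Dfun σP σR p β 0 (α + 1) * Efun σP σR p β u (α + 1)
          - Efun σP σR p β 0 (α + 1) * Dfun σP σR p β u (α + 1))
        / ((α + 1) * A)) :
    0 < A ∧
    (∀ u ∈ Set.Ioo (0 : ℝ) b,
      DifferentiableAt ℝ V u ∧ DifferentiableAt ℝ (deriv V) u) ∧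
    (∀ u ∈ Set.Ioo (0 : ℝ) b,
      (1 / 2) * (σP ^ 2 + σR ^ 2 * u ^ 2) * deriv (deriv V) u
        + (p + r * u) * deriv V u = δ * V u) ∧
    V 0 = 0 ∧
    deriv V b = 1 := by
  set s := Real.sqrt ((2 * r / σR ^ 2 - 1) ^ 2 + 8 * δ / σR ^ 2) with hs
  have hδ0 : 0 < δ := hr.trans hδ
  have hs2 : s ^ 2 = (2 * r / σR ^ 2 - 1) ^ 2 + 8 * δ / σR ^ 2 := Real.sq_sqrt (by positivity)
  have hq : 0 < r / σR ^ 2 := by positivity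
  have hs1 : 1 + 2 * r / σR ^ 2 < s := by
    refine Real.lt_sqrt_of_sq_lt ?_
    have h1 : r / σR ^ 2 < δ / σR ^ 2 := by gcongr
    have h2 : 2 * r / σR ^ 2 = 2 * (r / σR ^ 2) := by ring
    have h3 : 8 * δ / σR ^ 2 = 8 * (δ / σR ^ 2) := by ring
    rw [h2, h3]
    nlinarith
  have hr2 : 2 * r / σR ^ 2 = 2 * (r / σR ^ 2) := by ring
  have hα0 : 0 < α := by linarith
  have hαβ : α < β := by linarith
  have hβ0 : 0 < β := hα0.trans hαβ
  have hβα : β * σR ^ 2 = 2 * α * σR ^ 2 + 2 * r := by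
    rw [hβ, hα]
    field_simp
    ring
  have hδα : δ = σR ^ 2 / 2 * (α + 1) * α + r * (α + 1) := by
    have h1 : s = 2 * α + 1 + 2 * r / σR ^ 2 := by linarith
    rw [h1] at hs2
    field_simp at hs2
    refine mul_left_cancel₀ (show 8 * σR ^ 2 ≠ 0 by positivity) ?_
    linear_combination (-1) * hs2
  simp only [Efun_eq_Dfun_neg, Dfun_eq_kernelMoment hσP hσR, neg_zero] at hA hV
  have hpos : ∀ p x μ, 0 ≤ μ → μ < 1 + β → 0 < kernelMoment σP σR p β μ x :=
    fun p x μ h1 h2 => kernelMoment_pos hσP hσR hβ0 h1 h2 x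
  set d := kernelMoment σP σR p β (α + 1) 0
  set e := kernelMoment σP σR (-p) β (α + 1) 0
  have hd : 0 < d := hpos _ _ _ (by linarith) (by linarith)
  have he : 0 < e := hpos _ _ _ (by linarith) (by linarith)
  have hA0 : 0 < A := by
    rw [hA]
    have h1 := hpos p b α hα0.le (by linarith)
    have h2 := hpos (-p) (-b) α hα0.le (by linarith)
    positivity
  have hα1 : 0 < α + 1 := by linarith
  have hV' : ∀ u, HasDerivAt V
      ((d * kernelMoment σP σR (-p) β α (-u) + e * kernelMoment σP σR p β α u) / A) u := by
    intro u
    have h1 := (hasDerivAt_kernelMoment_add_one (p := -p) hσP hσR hβ0 hα0.le hαβ (-u)).comp u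
      (hasDerivAt_neg u)
    have h2 := hasDerivAt_kernelMoment_add_one (p := p) hσP hσR hβ0 hα0.le hαβ u
    rw [hV]
    refine (((h1.const_mul d).sub (h2.const_mul e)).div_const ((α + 1) * A)).congr_deriv ?_
    field_simp
    ring
  have hdV : deriv V = fun u =>
      (d * kernelMoment σP σR (-p) β α (-u) + e * kernelMoment σP σR p β α u) / A :=
    funext fun u => (hV' u).deriv
  have hV'' : ∀ u, HasDerivAt (deriv V)
      ((-(d * kernelDerivMoment σP σR (-p) β α (-u)) + e * kernelDerivMoment σP σR p β α u) / A)
      u := by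
    intro u
    have h1 := (hasDerivAt_kernelMoment (p := -p) hσP hσR hβ0 hα0.le (by linarith) (-u)).2.comp u
      (hasDerivAt_neg u)
    have h2 := (hasDerivAt_kernelMoment (p := p) hσP hσR hβ0 hα0.le (by linarith) u).2
    rw [hdV]
    refine (((h1.const_mul d).add (h2.const_mul e)).div_const A).congr_deriv ?_
    ring
  refine ⟨hA0, fun u _ => ⟨(hV' u).differentiableAt, (hV'' u).differentiableAt⟩,
    fun u _ => ?_, ?_, ?_⟩
  · have o1 := kernelMoment_ode (p := p) hσP hσR hβ0 hα0.le hαβ hβα hδα u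
    have o2 := kernelMoment_ode (p := -p) hσP hσR hβ0 hα0.le hαβ hβα hδα (-u)
    rw [(hV'' u).deriv, (hV' u).deriv, hV]
    field_simp
    linear_combination 2 * e * o1 - 2 * d * o2
  · simp only [hV, neg_zero]
    rw [mul_comm d e, sub_self, zero_div]
  · rw [hdV]
    simp only
    rw [div_eq_one_iff_eq hA0.ne', hA]
    ring
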